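/- arXiv:1901.08170 — 2 statements merged into one kernel-verified Lean document; each statement's English description precedes it below -/
import Mathlib

section
/- Let Hx and Hλ be Euclidean spaces, let f : Hx → ℝ be a convex function finite everywhere, and let L : Hx → Hλ be a linear map. Then the set-valued operator B on Hx × Hλ defined by B(x, λ) = (∂f(x) + Lᵀλ) × {−Lx}, where ∂f(x) + Lᵀλ denotes the translate of the subdifferential set ∂f(x) by the vector Lᵀλ, is a maximal monotone operator on Hx × Hλ (with the product inner product ⟨(x,λ),(x′,λ′)⟩ = ⟨x,x′⟩ + ⟨λ,λ′⟩). -/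
open scoped InnerProductSpace
open Set Pointwise

/-- The subdifferential of a real-valued convex function `f` at `x`. -/
def subdiffR {H : Type*} [NormedAddCommGroup H] [InnerProductSpace ℝ H]
    (f : H → ℝ) (x : H) : Set H :=
  {v | ∀ y, f x + ⟪v, y - x⟫_ℝ ≤ f y}

/-- The inner product on the product space `Hx × Hλ`:
`⟪(x,λ),(x′,λ′)⟫ = ⟪x,x′⟫ + ⟪λ,λ′⟫`. -/
def prodInner {Hx Hl : Type*}
    [NormedAddCommGroup Hx] [InnerProductSpace ℝ Hx]
    [NormedAddCommGroup Hl] [InnerProductSpace ℝ Hl]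
    (p q : Hx × Hl) : ℝ :=
  ⟪p.1, q.1⟫_ℝ + ⟪p.2, q.2⟫_ℝ

/-- A set-valued operator on `Hx × Hλ` is monotone (w.r.t. the product inner
product) if `⟪v − v′, p − p′⟫ ≥ 0` for all `(p,v)`, `(p′,v′)` in its graph. -/
def MonotoneOpProd {Hx Hl : Type*}
    [NormedAddCommGroup Hx] [InnerProductSpace ℝ Hx]
    [NormedAddCommGroup Hl] [InnerProductSpace ℝ Hl]
    (T : Hx × Hl → Set (Hx × Hl)) : Prop :=
  ∀ p p' v v', v ∈ T p → v' ∈ T p' → 0 ≤ prodInner (v - v') (p - p')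

/-- A finite convex function on a Euclidean space has a subgradient at every point. -/
lemma subdiffR_nonempty {H : Type*} [NormedAddCommGroup H] [InnerProductSpace ℝ H]
    [FiniteDimensional ℝ H] {f : H → ℝ} (hf : ConvexOn ℝ Set.univ f) (x : H) :
    (subdiffR f x).Nonempty := by
  have : CompleteSpace H := FiniteDimensional.complete ℝ H
  have hcont : Continuous f := hf.locallyLipschitz.continuous
  have hconv : Convex ℝ {p : H × ℝ | f p.1 < p.2} := by
    simpa using hf.convex_strict_epigraph
  have hopen : IsOpen {p : H × ℝ | f p.1 < p.2} :=
    isOpen_lt (hcont.comp continuous_fst) continuous_snd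
  obtain ⟨g, hg⟩ := geometric_hahn_banach_open_point (x := (x, f x)) hconv hopen (by simp)
  have hsplit (y : H) (s : ℝ) : g (y, s) = g (y, 0) + s * g (0, 1) := by
    rw [← smul_eq_mul, ← map_smul, ← map_add]
    simp
  have hneg : g (0, 1) < 0 := by
    have h := hg (x, f x + 1) (by simp)
    rw [hsplit, hsplit x (f x)] at h
    linarith
  have hle (y : H) : g (y, 0) + f y * g (0, 1) ≤ g (x, 0) + f x * g (0, 1) := by
    refine le_of_forall_pos_le_add fun ε hε => ?_
    have h := hg (y, f y + ε / (-g (0, 1))) (by simpa using div_pos hε (neg_pos.2 hneg))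
    rw [hsplit, hsplit x (f x)] at h
    have : ε / (-g (0, 1)) * g (0, 1) = -ε := by
      field_simp [hneg.ne]
    linarith
  refine ⟨(-g (0, 1))⁻¹ • (InnerProductSpace.toDual ℝ H).symm
    (g.comp (ContinuousLinearMap.inl ℝ H ℝ)), fun y => ?_⟩
  have hsub : g (y - x, 0) = g (y, 0) - g (x, 0) := by
    rw [← map_sub]
    simp
  have hdiv : (-g (0, 1))⁻¹ * (g (y, 0) - g (x, 0)) ≤ f y - f x := by
    rw [inv_mul_le_iff₀ (neg_pos.2 hneg)]
    linarith [hle y]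
  rw [real_inner_smul_left, InnerProductSpace.toDual_symm_apply]
  simp only [ContinuousLinearMap.comp_apply, ContinuousLinearMap.inl_apply, hsub]
  linarith

/-- The subdifferential of any function is monotone. -/
lemma inner_sub_nonneg_of_mem_subdiffR {H : Type*} [NormedAddCommGroup H]
    [InnerProductSpace ℝ H] {f : H → ℝ} {x y u v : H}
    (hu : u ∈ subdiffR f x) (hv : v ∈ subdiffR f y) : 0 ≤ ⟪u - v, x - y⟫_ℝ := by
  have h₁ := hu y
  have h₂ := hv x
  rw [← neg_sub x y, inner_neg_right] at h₁
  rw [inner_sub_left]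
  linarith

/-- The subdifferential of a finite convex function is maximal monotone: a vector monotonically
related to its whole graph belongs to it. -/
lemma mem_subdiffR_of_forall_inner_nonneg {H : Type*} [NormedAddCommGroup H]
    [InnerProductSpace ℝ H] [FiniteDimensional ℝ H] {f : H → ℝ}
    (hf : ConvexOn ℝ Set.univ f) {x u : H}
    (h : ∀ y, ∀ v ∈ subdiffR f y, 0 ≤ ⟪u - v, x - y⟫_ℝ) : u ∈ subdiffR f x := by
  intro y
  have hcont : Continuous f := hf.locallyLipschitz.continuous
  have key : ∀ t ∈ Set.Ioo (0 : ℝ) 1,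
      f (x + t • (y - x)) + (1 - t) * ⟪u, y - x⟫_ℝ ≤ f y := by
    rintro t ⟨ht₀, ht₁⟩
    obtain ⟨v, hv⟩ := subdiffR_nonempty hf (x + t • (y - x))
    have h₁ := h _ v hv
    have h₂ := hv y
    rw [show x - (x + t • (y - x)) = (-t) • (y - x) by module, real_inner_smul_right,
      inner_sub_left] at h₁
    rw [show y - (x + t • (y - x)) = (1 - t) • (y - x) by module, real_inner_smul_right] at h₂
    have h₃ : ⟪u, y - x⟫_ℝ ≤ ⟪v, y - x⟫_ℝ := by
      by_contra! hlt
      nlinarith [mul_pos ht₀ (sub_pos.2 hlt)]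
    nlinarith [mul_le_mul_of_nonneg_left h₃ (sub_nonneg.2 ht₁.le)]
  have hlim : Filter.Tendsto (fun t : ℝ => f (x + t • (y - x)) + (1 - t) * ⟪u, y - x⟫_ℝ)
      (nhdsWithin 0 (Set.Ioi 0)) (nhds (f x + ⟪u, y - x⟫_ℝ)) := by
    have hc : Continuous fun t : ℝ => f (x + t • (y - x)) + (1 - t) * ⟪u, y - x⟫_ℝ := by
      fun_prop
    have := (hc.tendsto 0).mono_left (nhdsWithin_le_nhds (s := Set.Ioi 0))
    simpa using this
  exact le_of_tendsto hlim (Filter.eventually_of_mem (Ioo_mem_nhdsGT one_pos) key)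

/-- **Maximal monotonicity of the operator `B(x,λ) = (∂f(x) + Lᵀλ) × {−Lx}`.**
For `f : Hx → ℝ` convex finite everywhere and `L : Hx → Hλ` linear, the
set-valued operator `B` on `Hx × Hλ` given by
`B(x,λ) = (∂f(x) + Lᵀλ) × {−Lx}` is maximal monotone for the product inner
product. -/
theorem saddle_operator_maximal_monotone
    {Hx Hl : Type*}
    [NormedAddCommGroup Hx] [InnerProductSpace ℝ Hx] [FiniteDimensional ℝ Hx]
    [NormedAddCommGroup Hl] [InnerProductSpace ℝ Hl] [FiniteDimensional ℝ Hl]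
    (f : Hx → ℝ) (hf : ConvexOn ℝ Set.univ f)
    (L : Hx →ₗ[ℝ] Hl)
    (B : Hx × Hl → Set (Hx × Hl))
    (hB : ∀ p : Hx × Hl,
      B p = (subdiffR f p.1 + ({(LinearMap.adjoint L) p.2} : Set Hx)) ×ˢ
              ({-(L p.1)} : Set Hl)) :
    MonotoneOpProd B ∧
      ∀ T : Hx × Hl → Set (Hx × Hl), MonotoneOpProd T →
        (∀ p, B p ⊆ T p) → ∀ p q, q ∈ T p → q ∈ B p := by
  have hmem (x : Hx) (l : Hl) (v : Hx) (hv : v ∈ subdiffR f x) :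
      (v + LinearMap.adjoint L l, -L x) ∈ B (x, l) := by
    rw [hB]
    exact ⟨Set.add_mem_add hv rfl, rfl⟩
  have hprod (x x' u v : Hx) (l l' w : Hl) :
      prodInner ((u, w) - (v + LinearMap.adjoint L l', -L x')) ((x, l) - (x', l')) =
        ⟪u - LinearMap.adjoint L l - v, x - x'⟫_ℝ + ⟪w + L x, l - l'⟫_ℝ := by
    simp only [prodInner, Prod.mk_sub_mk, inner_sub_left, inner_sub_right, inner_add_left,
      inner_add_right, inner_neg_right, LinearMap.adjoint_inner_left, real_inner_comm l, real_inner_comm l']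
    ring
  constructor
  · rintro ⟨x, l⟩ ⟨x', l'⟩ ⟨a, b⟩ ⟨a', b'⟩ hq hq'
    rw [hB] at hq hq'
    obtain ⟨⟨u, hu, _, rfl, rfl⟩, rfl⟩ := hq
    obtain ⟨⟨v, hv, _, rfl, rfl⟩, rfl⟩ := hq'
    have := inner_sub_nonneg_of_mem_subdiffR hu hv
    rw [hprod]
    simpa using this
  · rintro T hT hBT ⟨x, l⟩ ⟨u, w⟩ hq
    have hrel (x' : Hx) (l' : Hl) (v : Hx) (hv : v ∈ subdiffR f x') :
        0 ≤ ⟪u - LinearMap.adjoint L l - v, x - x'⟫_ℝ + ⟪w + L x, l - l'⟫_ℝ := by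
      rw [← hprod]
      exact hT _ _ _ _ hq (hBT _ (hmem x' l' v hv))
    have hw : w = -L x := by
      obtain ⟨v, hv⟩ := subdiffR_nonempty hf x
      have := hrel x (l + (w + L x)) v hv
      rw [sub_self, inner_zero_right, zero_add, sub_add_cancel_left, inner_neg_right,
        neg_nonneg] at this
      exact eq_neg_of_add_eq_zero_left (real_inner_self_nonpos.1 this)
    have hu : u - LinearMap.adjoint L l ∈ subdiffR f x :=
      mem_subdiffR_of_forall_inner_nonneg hf fun y v hv => by
        simpa using hrel y l v hv
    simpa [hw] using hmem x l _ hu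
end

section
/- Let H be a Euclidean space and let C₁, …, C_m ⊆ H be closed convex sets with C = ∩_{i=1}^m C_i nonempty. Suppose the collection is linearly regular: there exists κ > 0 such that for every x ∈ H, max_{i=1,…,m} dist(x, C_i) ≥ κ · dist(x, C). Then for every x ∈ C, the normal cone of the intersection decomposes as the Minkowski sum N_C(x) = N_{C₁}(x) + ⋯ + N_{C_m}(x). -/
open scoped InnerProductSpace BigOperators
open Set

/-- The normal cone of a set `C` at `x ∈ C`:
`{ v : ∀ y ∈ C, ⟪v, y − x⟫ ≤ 0 }`. -/
def normalCone {H : Type*} [NormedAddCommGroup H] [InnerProductSpace ℝ H]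
    (C : Set H) (x : H) : Set H :=
  {v | ∀ y ∈ C, ⟪v, y - x⟫_ℝ ≤ 0}

theorem convex_normalCone {H : Type*} [NormedAddCommGroup H] [InnerProductSpace ℝ H]
    (C : Set H) (x : H) : Convex ℝ (normalCone C x) := by
  intro u hu v hv a b ha hb _ y hy
  rw [inner_add_left, real_inner_smul_left, real_inner_smul_left]
  nlinarith [mul_nonpos_of_nonneg_of_nonpos ha (hu y hy),
    mul_nonpos_of_nonneg_of_nonpos hb (hv y hy)]

theorem smul_mem_normalCone {H : Type*} [NormedAddCommGroup H] [InnerProductSpace ℝ H]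
    {C : Set H} {x v : H} {a : ℝ} (ha : 0 ≤ a) (hv : v ∈ normalCone C x) :
    a • v ∈ normalCone C x := by
  intro y hy
  rw [real_inner_smul_left]
  exact mul_nonpos_of_nonneg_of_nonpos ha (hv y hy)

/-- The graph of the normal cone map is sequentially closed. -/
theorem mem_normalCone_of_tendsto {H : Type*} [NormedAddCommGroup H] [InnerProductSpace ℝ H]
    {C : Set H} {x v : H} {p u : ℕ → H} (hp : Filter.Tendsto p Filter.atTop (nhds x))
    (hu : Filter.Tendsto u Filter.atTop (nhds v)) (h : ∀ n, u n ∈ normalCone C (p n)) :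
    v ∈ normalCone C x := fun y hy =>
  le_of_tendsto (hu.inner (tendsto_const_nhds.sub hp)) (Filter.Eventually.of_forall
    fun n => h n y hy)

theorem isClosed_normalCone {H : Type*} [NormedAddCommGroup H] [InnerProductSpace ℝ H]
    (C : Set H) (x : H) : IsClosed (normalCone C x) :=
  IsSeqClosed.isClosed fun _ _ hu hv => mem_normalCone_of_tendsto tendsto_const_nhds hv hu

/-- The metric projection onto a closed convex set. -/
theorem exists_projection_mem_normalCone {H : Type*} [NormedAddCommGroup H]
    [InnerProductSpace ℝ H] [CompleteSpace H] {C : Set H} (hclosed : IsClosed C)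
    (hconv : Convex ℝ C) (hne : C.Nonempty) (y : H) :
    ∃ p ∈ C, Metric.infDist y C = ‖y - p‖ ∧ y - p ∈ normalCone C p := by
  obtain ⟨p, hp, hpy⟩ := exists_norm_eq_iInf_of_complete_convex hne hclosed.isComplete hconv y
  refine ⟨p, hp, ?_, (norm_eq_iInf_iff_real_inner_le_zero hconv hp).1 hpy⟩
  rw [hpy, Metric.infDist_eq_iInf]
  simp only [dist_eq_norm]

/-- A normal vector of length at most `R` at a point of `C` near `x + t • d` which bounds the
distance of `x + t • d` to `C`. -/
theorem exists_normal_bounding_infDist {H : Type*} [NormedAddCommGroup H]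
    [InnerProductSpace ℝ H] [CompleteSpace H] {C : Set H} (hclosed : IsClosed C)
    (hconv : Convex ℝ C) {x : H} (hx : x ∈ C) (d : H) {t R : ℝ} (ht : 0 ≤ t) (hR : 0 ≤ R) :
    ∃ p v : H, v ∈ normalCone C p ∧ ‖v‖ ≤ R ∧ dist p x ≤ 2 * (t * ‖d‖) ∧
      R * Metric.infDist (x + t • d) C ≤ t * ⟪v, d⟫_ℝ := by
  obtain ⟨p, hp, hdist, hnormal⟩ :=
    exists_projection_mem_normalCone hclosed hconv ⟨x, hx⟩ (x + t • d)
  set u := x + t • d - p with hu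
  have hv : (R * ‖u‖⁻¹) • u ∈ normalCone C p := smul_mem_normalCone (by positivity) hnormal
  have hnorm : ‖u‖ ≤ t * ‖d‖ := by
    rw [← hdist]
    refine (Metric.infDist_le_dist_of_mem hx).trans_eq ?_
    rw [dist_eq_norm, add_sub_cancel_left, norm_smul, Real.norm_of_nonneg ht]
  refine ⟨p, (R * ‖u‖⁻¹) • u, hv, ?_, ?_, ?_⟩
  · rw [norm_smul, Real.norm_of_nonneg (by positivity), mul_assoc]
    exact mul_le_of_le_one_right hR inv_mul_le_one
  · have hpx : p - x = t • d - u := by rw [hu]; abel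
    rw [dist_eq_norm, hpx]
    refine (norm_sub_le _ _).trans ?_
    rw [norm_smul, Real.norm_of_nonneg ht]
    linarith
  · have hsplit : t • d = u + (p - x) := by rw [hu]; abel
    have huu : ⟪(R * ‖u‖⁻¹) • u, u⟫_ℝ = R * ‖u‖ := by
      rw [real_inner_smul_left, real_inner_self_eq_norm_sq]
      rcases eq_or_ne ‖u‖ 0 with h | h
      · simp [h]
      · field_simp
    have hle := hv x hx
    rw [← neg_sub p x, inner_neg_right] at hle
    rw [hdist, ← real_inner_smul_right, hsplit, inner_add_right, huu]
    linarith

/-- A normal vector `w` of `C` at `x` bounds the distance to `C` from below. -/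
theorem inner_le_norm_mul_infDist {H : Type*} [NormedAddCommGroup H] [InnerProductSpace ℝ H]
    {C : Set H} {x w : H} (hx : x ∈ C) (hw : w ∈ normalCone C x) (y : H) :
    ⟪w, y - x⟫_ℝ ≤ ‖w‖ * Metric.infDist y C := by
  rcases eq_or_ne w 0 with rfl | h0
  · simp
  rw [mul_comm, ← div_le_iff₀ (norm_pos_iff.2 h0)]
  refine (Metric.le_infDist ⟨x, hx⟩).2 fun p hp => ?_
  rw [div_le_iff₀ (norm_pos_iff.2 h0), dist_eq_norm, ← sub_add_sub_cancel y p x, inner_add_right]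
  have h1 := hw p hp
  have h2 := real_inner_le_norm w (y - p)
  linarith

/-- Normal vectors of the sets `C i` of bounded length dominate a normal vector of the
intersection in any given direction. -/
theorem exists_normals_inner_le {H : Type*} [NormedAddCommGroup H] [InnerProductSpace ℝ H]
    [FiniteDimensional ℝ H] {ι : Type*} [Fintype ι] {C : ι → Set H}
    (hclosed : ∀ i, IsClosed (C i)) (hconv : ∀ i, Convex ℝ (C i)) {κ : ℝ} (hκ : 0 < κ)
    (hreg : ∀ x : H, κ * Metric.infDist x (⋂ i, C i) ≤ ⨆ i, Metric.infDist x (C i))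
    {x w : H} (hx : x ∈ ⋂ i, C i) (hw : w ∈ normalCone (⋂ i, C i) x) (d : H) :
    ∃ v : ι → H, (∀ i, v i ∈ normalCone (C i) x ∩ Metric.closedBall 0 (‖w‖ / κ)) ∧
      ⟪w, d⟫_ℝ ≤ ⟪∑ i, v i, d⟫_ℝ := by
  have hR : 0 ≤ ‖w‖ / κ := by positivity
  have hpos : ∀ n : ℕ, (0 : ℝ) < 1 / ((n : ℝ) + 1) := fun n => Nat.one_div_pos_of_nat
  choose p v hv hvR hpx hbound using fun (n : ℕ) (i : ι) =>
    exists_normal_bounding_infDist (hclosed i) (hconv i) (mem_iInter.1 hx i) d (hpos n).le hR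
  have hle : ∀ n, ⟪w, d⟫_ℝ ≤ ⟪∑ i, v n i, d⟫_ℝ := by
    intro n
    have hdist := inner_le_norm_mul_infDist hx hw (x + (1 / ((n : ℝ) + 1)) • d)
    rw [add_sub_cancel_left, real_inner_smul_right] at hdist
    have hsup : (⨆ i, Metric.infDist (x + (1 / ((n : ℝ) + 1)) • d) (C i)) ≤
        ∑ i, Metric.infDist (x + (1 / ((n : ℝ) + 1)) • d) (C i) :=
      Real.iSup_le (fun i => Finset.single_le_sum
        (f := fun i => Metric.infDist (x + (1 / ((n : ℝ) + 1)) • d) (C i))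
        (fun j _ => Metric.infDist_nonneg) (Finset.mem_univ i))
        (Finset.sum_nonneg fun j _ => Metric.infDist_nonneg)
    refine le_of_mul_le_mul_left ?_ (hpos n)
    calc (1 / ((n : ℝ) + 1)) * ⟪w, d⟫_ℝ
        ≤ ‖w‖ * Metric.infDist (x + (1 / ((n : ℝ) + 1)) • d) (⋂ i, C i) := hdist
      _ = ‖w‖ / κ * (κ * Metric.infDist (x + (1 / ((n : ℝ) + 1)) • d) (⋂ i, C i)) := by
          field_simp
      _ ≤ ‖w‖ / κ * ∑ i, Metric.infDist (x + (1 / ((n : ℝ) + 1)) • d) (C i) :=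
          mul_le_mul_of_nonneg_left ((hreg _).trans hsup) hR
      _ ≤ (1 / ((n : ℝ) + 1)) * ⟪∑ i, v n i, d⟫_ℝ := by
          rw [sum_inner, Finset.mul_sum, Finset.mul_sum]
          exact Finset.sum_le_sum fun i _ => hbound n i
  obtain ⟨v₀, hv₀, φ, hφ, hlim⟩ :=
    (isCompact_univ_pi fun _ : ι => isCompact_closedBall (0 : H) (‖w‖ / κ)).tendsto_subseq
      (x := v) fun n i _ => mem_closedBall_zero_iff.2 (hvR n i)
  rw [tendsto_pi_nhds] at hlim
  refine ⟨v₀, fun i => ⟨?_, hv₀ i (mem_univ i)⟩, ?_⟩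
  · have hp : Filter.Tendsto (fun n => p n i) Filter.atTop (nhds x) := by
      rw [tendsto_iff_dist_tendsto_zero]
      refine squeeze_zero (fun _ => dist_nonneg) (fun n => hpx n i) ?_
      simpa using (tendsto_one_div_add_atTop_nhds_zero_nat (𝕜 := ℝ)).mul_const ‖d‖ |>.const_mul 2
    exact mem_normalCone_of_tendsto (hp.comp hφ.tendsto_atTop) (hlim i) fun n => hv (φ n) i
  · exact ge_of_tendsto ((tendsto_finsetSum _ fun i _ => hlim i).inner tendsto_const_nhds)
      (Filter.Eventually.of_forall fun n => hle (φ n))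

/-- **Linear regularity implies the normal cone decomposition.**
Let `C₁, …, C_m` be closed convex sets with nonempty intersection `C`.
If there exists `κ > 0` with `max_i dist(x, C_i) ≥ κ · dist(x, C)` for all
`x`, then for every `x ∈ C`,
`N_C(x) = N_{C₁}(x) + ⋯ + N_{C_m}(x)` (Minkowski sum). -/
theorem linear_regularity_normal_cone_sum
    {H : Type*} [NormedAddCommGroup H] [InnerProductSpace ℝ H]
    [FiniteDimensional ℝ H]
    (m : ℕ) (C : Fin m → Set H)
    (hclosed : ∀ i, IsClosed (C i)) (hconv : ∀ i, Convex ℝ (C i))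
    (hne : (⋂ i, C i).Nonempty)
    (κ : ℝ) (hκ : 0 < κ)
    (hreg : ∀ x : H,
      κ * Metric.infDist x (⋂ i, C i) ≤ ⨆ i : Fin m, Metric.infDist x (C i)) :
    ∀ x ∈ ⋂ i, C i,
      normalCone (⋂ i, C i) x
        = {w | ∃ v : Fin m → H, (∀ i, v i ∈ normalCone (C i) x) ∧ w = ∑ i, v i} := by
  intro x hx
  ext w
  constructor
  · intro hw
    let P : Set (Fin m → H) :=
      Set.univ.pi fun i => normalCone (C i) x ∩ Metric.closedBall 0 (‖w‖ / κ)
    let S : (Fin m → H) →ₗ[ℝ] H := ∑ i, LinearMap.proj i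
    have hS : ∀ v, S v = ∑ i, v i := fun v => by simp [S]
    have hPcompact : IsCompact P := isCompact_univ_pi fun i =>
      (isCompact_closedBall 0 _).inter_left (isClosed_normalCone (C i) x)
    have hPconvex : Convex ℝ P := convex_pi fun i _ =>
      (convex_normalCone (C i) x).inter (convex_closedBall 0 _)
    have hmem : w ∈ S '' P := by
      by_contra hnot
      obtain ⟨f, u, hlt, hgt⟩ := geometric_hahn_banach_closed_point (hPconvex.linear_image S)
        (hPcompact.image S.continuous_of_finiteDimensional).isClosed hnot
      obtain ⟨v, hv, hle⟩ := exists_normals_inner_le hclosed hconv hκ hreg hx hw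
        ((InnerProductSpace.toDual ℝ H).symm f)
      have hvlt := hlt (S v) (mem_image_of_mem S fun i _ => hv i)
      rw [real_inner_comm, InnerProductSpace.toDual_symm_apply, real_inner_comm,
        InnerProductSpace.toDual_symm_apply, ← hS] at hle
      linarith
    obtain ⟨v, hv, rfl⟩ := hmem
    exact ⟨v, fun i => (hv i (mem_univ i)).1, hS v⟩
  · rintro ⟨v, hv, rfl⟩ y hy
    rw [sum_inner]
    exact Finset.sum_nonpos fun i _ => hv i y (mem_iInter.1 hy i)
end
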